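/- For every simple digraph H there exists a constant c_H such that every H-immersion-free tournament T satisfies ctw(T) ≤ c_H. -/

import Mathlib

namespace TournamentPaper

open Classical

/-- A finite simple directed graph. -/
structure Digr (V : Type) where
  Adj : V → V → Prop
  loopless : ∀ v, ¬ Adj v v

namespace Digr

variable {V : Type}

/-- A tournament: exactly one of the two arcs between any two distinct vertices. -/
def IsTournament (T : Digr V) : Prop :=
  ∀ u v : V, u ≠ v → (T.Adj u v ↔ ¬ T.Adj v u)

/-- The arc set, as a set of ordered pairs. -/
def arcs (T : Digr V) : Set (V × V) := {e | T.Adj e.1 e.2}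

/-- The subdigraph induced by a set of vertices. -/
def induce (T : Digr V) (X : Set V) : Digr V where
  Adj u v := u ∈ X ∧ v ∈ X ∧ T.Adj u v
  loopless v h := T.loopless v h.2.2

/-- Deletion of a set of arcs. -/
def deleteArcs (T : Digr V) (F : Set (V × V)) : Digr V where
  Adj u v := T.Adj u v ∧ (u, v) ∉ F
  loopless v h := T.loopless v h.1

/-- Outdegree of a vertex. -/
noncomputable def outdeg (T : Digr V) (u : V) : ℕ := {v | T.Adj u v}.ncard

end Digr

variable {V : Type}

/-- An ordering of the vertex set: a bijection onto `{1, …, |V|}`. -/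
def IsOrdering [Fintype V] (σ : V → ℕ) : Prop :=
  Set.BijOn σ Set.univ (Set.Icc 1 (Fintype.card V))

/-- The `γ`-cut of an ordering: arcs `(u,v)` with `σ u > γ ≥ σ v`. -/
def cutAt (T : Digr V) (σ : V → ℕ) (γ : ℕ) : Set (V × V) :=
  {e | T.Adj e.1 e.2 ∧ γ < σ e.1 ∧ σ e.2 ≤ γ}

/-- The width of an ordering: the maximal size of a cut. -/
noncomputable def width [Fintype V] (T : Digr V) (σ : V → ℕ) : ℕ :=
  (Finset.range (Fintype.card V + 1)).sup fun γ => (cutAt T σ γ).ncard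

/-- The cutwidth: the minimum width over all orderings. -/
noncomputable def ctw [Fintype V] (T : Digr V) : ℕ :=
  sInf {w | ∃ σ : V → ℕ, IsOrdering σ ∧ width T σ = w}

/-- The σ-interval `σ(a, b]`. -/
def interval (σ : V → ℕ) (a b : ℕ) : Set V := {v | a < σ v ∧ σ v ≤ b}

/-- Arcs of `T` from `X` to `Y`. -/
def arcsBetween (T : Digr V) (X Y : Set V) : Set (V × V) :=
  {e | T.Adj e.1 e.2 ∧ e.1 ∈ X ∧ e.2 ∈ Y}

/-- `∂⁺(I)` for `I = σ(a,b]`: arcs from `I` to `σ(0,a]`. -/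
def dPlus [Fintype V] (T : Digr V) (σ : V → ℕ) (a b : ℕ) : Set (V × V) :=
  arcsBetween T (interval σ a b) (interval σ 0 a)

/-- `∂⁻(I)`: arcs from `σ(b,|V|]` to `I`. -/
def dMinus [Fintype V] (T : Digr V) (σ : V → ℕ) (a b : ℕ) : Set (V × V) :=
  arcsBetween T (interval σ b (Fintype.card V)) (interval σ a b)

/-- `Γ⁺(I)`: arcs from `I` to `σ(b,|V|]`. -/
def gPlus [Fintype V] (T : Digr V) (σ : V → ℕ) (a b : ℕ) : Set (V × V) :=
  arcsBetween T (interval σ a b) (interval σ b (Fintype.card V))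

/-- `Γ⁻(I)`: arcs from `σ(0,a]` to `I`. -/
def gMinus [Fintype V] (T : Digr V) (σ : V → ℕ) (a b : ℕ) : Set (V × V) :=
  arcsBetween T (interval σ 0 a) (interval σ a b)

/-- The interval `σ(a,b]` is `c`-flat: `|∂⁺| ≤ c`, `|∂⁻| ≤ c`, and the restriction
of `σ` to the induced subtournament has width at most `c`. -/
def Flat [Fintype V] (T : Digr V) (σ : V → ℕ) (a b c : ℕ) : Prop :=
  (dPlus T σ a b).ncard ≤ c ∧ (dMinus T σ a b).ncard ≤ c ∧
  ∀ γ : ℕ, (cutAt (T.induce (interval σ a b)) σ γ).ncard ≤ c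

/-- The list of arcs of a list of vertices (viewed as a walk). -/
def listArcs (l : List V) : List (V × V) := l.zip l.tail

/-- An immersion model of `H` in `G`: an injective vertex map together with, for each
arc of `H`, a directed simple path in `G` between the images of its endpoints, the
paths being pairwise arc-disjoint. -/
structure ImmersionModel {VH V : Type} (H : Digr VH) (G : Digr V) where
  vmap : VH → V
  inj : Function.Injective vmap
  path : ∀ e : VH × VH, H.Adj e.1 e.2 → List V
  chain : ∀ e he, (path e he).Chain' G.Adj
  nodup : ∀ e he, (path e he).Nodup
  head : ∀ e he, (path e he).head? = some (vmap e.1)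
  last : ∀ e he, (path e he).getLast? = some (vmap e.2)
  arc_disj : ∀ e he e' he', e ≠ e' → ∀ x ∈ listArcs (path e he), x ∉ listArcs (path e' he')

/-- The set of arcs of `G` used by an immersion model. -/
def ImmersionModel.arcsUsed {VH V : Type} {H : Digr VH} {G : Digr V}
    (M : ImmersionModel H G) : Set (V × V) :=
  {x | ∃ e he, x ∈ listArcs (M.path e he)}

/-- `G` contains `H` as an immersion. -/
def HasImm {VH V : Type} (H : Digr VH) (G : Digr V) : Prop :=
  Nonempty (ImmersionModel H G)

/-- A family of pairwise arc-disjoint immersion models. -/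
def ArcDisjointModels {VH V : Type} {H : Digr VH} {G : Digr V} {k : ℕ}
    (M : Fin k → ImmersionModel H G) : Prop :=
  ∀ i j, i ≠ j → Disjoint (M i).arcsUsed (M j).arcsUsed


/-- `N` pairwise arc-disjoint walks with at most five arcs each. -/
def Link (T : Digr V) (N : ℕ) (u v : V) : Prop :=
  ∃ P : Fin N → List V,
    (∀ q, (P q).IsChain T.Adj ∧ (P q).head? = some u ∧ (P q).getLast? = some v ∧
      (P q).length ≤ 6) ∧
    ∀ q q', q ≠ q' → ∀ x ∈ listArcs (P q), x ∉ listArcs (P q')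

lemma listArcs_cons_cons (a b : V) (l : List V) :
    listArcs (a :: b :: l) = (a, b) :: listArcs (b :: l) := by
  simp [listArcs]

lemma listArcs_suffix (p1 p2 : List V) : listArcs p2 ⊆ listArcs (p1 ++ p2) := by
  induction p1 with
  | nil => simp
  | cons a t ih =>
    intro x hx
    have := ih hx
    cases h : t ++ p2 with
    | nil => rw [h] at this; simp [listArcs] at this
    | cons b l =>
      rw [h] at this
      rw [List.cons_append, h, listArcs_cons_cons]
      exact List.mem_cons_of_mem _ this

lemma listArcs_length (l : List V) : (listArcs l).length ≤ l.length - 1 := by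
  simp [listArcs]

lemma shorten (T : Digr V) (l : List V) : ∀ (u v : V), l.IsChain T.Adj → l.head? = some u →
    l.getLast? = some v →
    ∃ p : List V, p.IsChain T.Adj ∧ p.Nodup ∧ p.head? = some u ∧ p.getLast? = some v ∧
      listArcs p ⊆ listArcs l := by
  induction l with
  | nil => intro u v _ h; simp at h
  | cons a t ih =>
    intro u v hc hh hl
    have hau : a = u := by simpa using hh
    subst hau
    cases t with
    | nil => exact ⟨[a], by simp, by simp, by simp, hl, by simp⟩
    | cons b t =>
      rw [List.isChain_cons_cons] at hc
      obtain ⟨p, h1, h2, h3, h4, h5⟩ := ih b v hc.2 (by simp) (by simpa using hl)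
      by_cases ha : a ∈ p
      · obtain ⟨p1, p2, rfl⟩ := List.append_of_mem ha
        refine ⟨a :: p2, ?_, ?_, by simp, ?_, ?_⟩
        · exact h1.suffix (List.suffix_append _ _)
        · exact h2.sublist (List.sublist_append_right _ _)
        · simpa using h4
        · intro x hx
          rw [listArcs_cons_cons]
          exact List.mem_cons_of_mem _ (h5 (listArcs_suffix p1 _ hx))
      · cases p with
        | nil => simp at h3
        | cons c p =>
          have : c = b := by simpa using h3
          subst this
          refine ⟨a :: c :: p, ?_, ?_, by simp, ?_, ?_⟩
          · rw [List.isChain_cons_cons]; exact ⟨hc.1, h1⟩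
          · exact List.nodup_cons.2 ⟨ha, h2⟩
          · simpa using h4
          · rw [listArcs_cons_cons, listArcs_cons_cons]
            exact List.cons_subset_cons _ h5

lemma link_avoid {T : Digr V} {N : ℕ} {u v : V} (h : Link T N u v) (U : Finset (V × V))
    (hU : U.card < N) :
    ∃ l : List V, l.IsChain T.Adj ∧ l.head? = some u ∧ l.getLast? = some v ∧
      l.length ≤ 6 ∧ ∀ x ∈ listArcs l, x ∉ U := by
  obtain ⟨P, hP, hd⟩ := h
  by_contra hcon
  have : ∀ q, ∃ x, x ∈ listArcs (P q) ∧ x ∈ U := by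
    intro q
    by_contra hq
    push Not at hq
    exact hcon ⟨P q, (hP q).1, (hP q).2.1, (hP q).2.2.1, (hP q).2.2.2, hq⟩
  choose g hg using this
  have hinj : Set.InjOn g ((Finset.univ : Finset (Fin N)) : Set (Fin N)) := by
    intro q _ q' _ hqq
    by_contra hne
    exact hd q q' hne (g q) (hg q).1 (hqq ▸ (hg q').1)
  have := Finset.card_le_card_of_injOn g (fun q _ => (hg q).2) hinj
  simp at this
  omega

lemma greedy_paths {VH : Type} (T : Digr V) (N : ℕ) (φ : VH → V) (S : Finset (VH × VH))
    (hS : ∀ e ∈ S, Link T N (φ e.1) (φ e.2)) (hN : 5 * S.card ≤ N) :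
    ∃ path : VH × VH → List V,
      (∀ e ∈ S, (path e).IsChain T.Adj ∧ (path e).head? = some (φ e.1) ∧
        (path e).getLast? = some (φ e.2) ∧ (path e).length ≤ 6) ∧
      ∀ e ∈ S, ∀ e' ∈ S, e ≠ e' → ∀ x ∈ listArcs (path e), x ∉ listArcs (path e') := by
  induction S using Finset.induction_on with
  | empty => exact ⟨fun _ => [], by simp, by simp⟩
  | insert a S ha ih =>
    rw [Finset.card_insert_of_notMem ha] at hN
    obtain ⟨path, h1, h2⟩ := ih (fun e he => hS e (Finset.mem_insert_of_mem he)) (by omega)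
    obtain ⟨l, l1, l2, l3, l4, l5⟩ := link_avoid (hS a (Finset.mem_insert_self _ _))
      (S.biUnion fun e => (listArcs (path e)).toFinset) (by
        have : (S.biUnion fun e => (listArcs (path e)).toFinset).card ≤ S.card * 5 := by
          apply Finset.card_biUnion_le_card_mul
          intro e he
          have := listArcs_length (path e)
          have := (h1 e he).2.2.2
          have := List.toFinset_card_le (listArcs (path e))
          omega
        omega)
    have l6 : ∀ x ∈ listArcs l, ∀ e ∈ S, x ∉ listArcs (path e) := by
      intro x hx e he hxe
      exact l5 x hx (Finset.mem_biUnion.2 ⟨e, he, by simpa using hxe⟩)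
    refine ⟨Function.update path a l, ?_, ?_⟩
    · intro e he
      by_cases hea : e = a
      · subst hea; simp [l1, l2, l3, l4]
      · rw [Function.update_of_ne hea]
        exact h1 e ((Finset.mem_insert.1 he).resolve_left hea)
    · intro e he e' he' hne x hx
      by_cases hea : e = a
      · have hea' : e' ≠ a := fun h => hne (hea.trans h.symm)
        subst hea
        rw [Function.update_self] at hx
        rw [Function.update_of_ne hea']
        exact l6 x hx e' ((Finset.mem_insert.1 he').resolve_left hea')
      · have he2 := (Finset.mem_insert.1 he).resolve_left hea
        rw [Function.update_of_ne hea] at hx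
        by_cases hea' : e' = a
        · subst hea'
          rw [Function.update_self]
          exact fun hx' => l6 x hx' e he2 hx
        · rw [Function.update_of_ne hea']
          exact h2 e he2 e' ((Finset.mem_insert.1 he').resolve_left hea') hne x hx

lemma hasImm_of_link {VH : Type} [Fintype VH] (H : Digr VH) (T : Digr V) (N : ℕ)
    (hN : 5 * Fintype.card (VH × VH) ≤ N) (φ : VH → V) (hφ : Function.Injective φ)
    (hl : ∀ x y, x ≠ y → Link T N (φ x) (φ y)) : HasImm H T := by
  obtain ⟨path, h1, h2⟩ := greedy_paths T N φ
    (Finset.univ.filter fun e : VH × VH => e.1 ≠ e.2) (by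
      intro e he
      exact hl _ _ (by simpa using he)) (by
      refine le_trans (Nat.mul_le_mul_left _ (Finset.card_le_univ _)) hN)
  have hne : ∀ e : VH × VH, H.Adj e.1 e.2 →
      e ∈ (Finset.univ.filter fun e : VH × VH => e.1 ≠ e.2) := by
    intro e he
    simp only [Finset.mem_filter, Finset.mem_univ, true_and]
    intro h
    rw [h] at he
    exact H.loopless _ he
  have h3 : ∀ e : VH × VH, H.Adj e.1 e.2 → ∃ p : List V, p.IsChain T.Adj ∧ p.Nodup ∧
      p.head? = some (φ e.1) ∧ p.getLast? = some (φ e.2) ∧ listArcs p ⊆ listArcs (path e) :=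
    fun e he => shorten T (path e) _ _ (h1 e (hne e he)).1 (h1 e (hne e he)).2.1
      (h1 e (hne e he)).2.2.1
  choose p p1 p2 p3 p4 p5 using h3
  exact ⟨⟨φ, hφ, p, p1, p2, p3, p4, fun e he e' he' hee x hx hx' =>
    h2 e (hne e he) e' (hne e' he') hee x (p5 e he hx) (p5 e' he' hx')⟩⟩

/-- A large set with a total relation contains a long transitive sequence. -/
lemma exists_transitive {α : Type} (R : α → α → Prop) (m : ℕ) : ∀ (I : Finset α),
    (∀ x ∈ I, ∀ y ∈ I, x ≠ y → R x y ∨ R y x) → 2 ^ m ≤ I.card →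
    ∃ g : ℕ → α, (∀ i < m, g i ∈ I) ∧ ∀ i j, i < j → j < m → R (g i) (g j) := by
  induction m with
  | zero =>
    intro I _ hc
    obtain ⟨x, hx⟩ := Finset.card_pos.1 (by omega : 0 < I.card)
    exact ⟨fun _ => x, by simp, by simp⟩
  | succ m ih =>
    intro I hI hc
    obtain ⟨x, hx⟩ := Finset.card_pos.1 (lt_of_lt_of_le (by positivity) hc)
    have hsplit := Finset.card_filter_add_card_filter_not (s := I.erase x) (fun y => R x y)
    rw [Finset.card_erase_of_mem hx] at hsplit
    rw [pow_succ] at hc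
    have hcases : 2 ^ m ≤ ((I.erase x).filter fun y => R x y).card ∨
        2 ^ m ≤ ((I.erase x).filter fun y => ¬ R x y).card := by
      have : 0 < 2 ^ m := by positivity
      by_contra hcon
      push Not at hcon
      omega
    rcases hcases with h | h
    · obtain ⟨g, g1, g2⟩ := ih _ (fun y hy z hz hyz => hI y
        (Finset.mem_of_mem_erase (Finset.mem_filter.1 hy).1) z
        (Finset.mem_of_mem_erase (Finset.mem_filter.1 hz).1) hyz) h
      have g3 := fun i hi => Finset.mem_filter.1 (g1 i hi)
      refine ⟨fun i => Nat.casesOn i x g, ?_, ?_⟩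
      · rintro (_ | i) hi
        · exact hx
        · exact Finset.mem_of_mem_erase (g3 i (by omega)).1
      · rintro (_ | i) (_ | j) hij hj
        · omega
        · exact (g3 j (by omega)).2
        · omega
        · exact g2 i j (by omega) (by omega)
    · obtain ⟨g, g1, g2⟩ := ih _ (fun y hy z hz hyz => hI y
        (Finset.mem_of_mem_erase (Finset.mem_filter.1 hy).1) z
        (Finset.mem_of_mem_erase (Finset.mem_filter.1 hz).1) hyz) h
      have g3 := fun i hi => Finset.mem_filter.1 (g1 i hi)
      refine ⟨fun i => if i < m then g i else x, ?_, ?_⟩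
      · intro i hi
        dsimp only
        split_ifs with him
        · exact Finset.mem_of_mem_erase (g3 i him).1
        · exact hx
      · intro i j hij hj
        have him : i < m := by omega
        simp only [him, if_true]
        split_ifs with hjm
        · exact g2 i j hij hjm
        · have := Finset.mem_erase.1 (g3 i him).1
          exact (hI _ this.2 x hx this.1).resolve_right (g3 i him).2

/-- two-arc walks through many middle vertices -/
lemma link_of_mid {T : Digr V} {N : ℕ} {u v : V} (R : Finset V)
    (hR : ∀ w ∈ R, T.Adj u w ∧ T.Adj w v) (huv : u ≠ v) (hN : N ≤ R.card) : Link T N u v := by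
  obtain ⟨R', hR', hc⟩ := Finset.exists_subset_card_eq hN
  let e := (R'.equivFin.trans (finCongr hc)).symm
  have he : ∀ q, T.Adj u (e q) ∧ T.Adj (e q) v := fun q => hR _ (hR' (e q).2)
  refine ⟨fun q => [u, e q, v], ?_, ?_⟩
  · intro q
    simp [he q]
  · intro q q' hq x hx hx'
    have : (e q : V) ≠ e q' := fun h => hq (e.injective (Subtype.ext h))
    have hu : ∀ q, (e q : V) ≠ u := fun q h => T.loopless u (by have := (he q).1; rwa [h] at this)
    have hv : ∀ q, (e q : V) ≠ v := fun q h => T.loopless v (by have := (he q).2; rwa [h] at this)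
    simp [listArcs] at hx hx'
    have := hu q
    have := hu q'
    grind

/-- A long transitive sequence with backward links yields an immersion. -/
lemma hasImm_of_transitive {VH : Type} [Fintype VH] (H : Digr VH) (T : Digr V) (N S : ℕ)
    (hN : 5 * Fintype.card (VH × VH) ≤ N) (hS : N + 1 ≤ S) (f : ℕ → V)
    (hf : ∀ i j, i < j → j < (Fintype.card VH + 2) * S → T.Adj (f i) (f j))
    (hb : ∀ i j, i < j → j < Fintype.card VH →
      Link T N (f ((j + 1) * S)) (f ((i + 1) * S))) : HasImm H T := by
  have hlt : ∀ i j, i < j → (i + 1) * S + S ≤ (j + 1) * S := by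
    intro i j hij
    nlinarith [Nat.mul_le_mul_right S (by omega : i + 2 ≤ j + 1)]
  have hM : ∀ j, j < Fintype.card VH → (j + 1) * S + S ≤ (Fintype.card VH + 2) * S := by
    intro j hj
    nlinarith [Nat.mul_le_mul_right S (by omega : j + 2 ≤ Fintype.card VH + 2)]
  have hfinj : ∀ i j, i < j → j < (Fintype.card VH + 2) * S → f i ≠ f j := by
    intro i j hij hj h
    have := hf i j hij hj
    rw [h] at this
    exact T.loopless _ this
  have hfw : ∀ i j, i < j → j < Fintype.card VH →
      Link T N (f ((i + 1) * S)) (f ((j + 1) * S)) := by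
    intro i j hij hj
    have h1 := hlt i j hij
    have h2 := hM j hj
    apply link_of_mid ((Finset.range N).image fun q => f ((i + 1) * S + 1 + q))
    · intro w hw
      obtain ⟨q, hq, rfl⟩ := Finset.mem_image.1 hw
      have hq := Finset.mem_range.1 hq
      exact ⟨hf _ _ (by omega) (by omega), hf _ _ (by omega) (by omega)⟩
    · exact hfinj _ _ (by omega) (by omega)
    · rw [Finset.card_image_of_injOn, Finset.card_range]
      intro a ha b hb hab
      have ha := Finset.mem_range.1 ha
      have hb := Finset.mem_range.1 hb
      by_contra hne
      rcases lt_or_gt_of_ne hne with h | h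
      · exact hfinj _ _ (by omega) (by omega) hab
      · exact hfinj _ _ (by omega) (by omega) hab.symm
  let e := Fintype.equivFin VH
  apply hasImm_of_link H T N hN (fun x => f (((e x : ℕ) + 1) * S))
  · intro x y hxy
    by_contra hne
    have : (e x : ℕ) ≠ e y := fun h => hne (e.injective (Fin.ext h))
    rcases lt_or_gt_of_ne this with h | h
    · exact hfinj _ _ (by have := hlt _ _ h; omega) (by have := hM _ (e y).2; omega) hxy
    · exact hfinj _ _ (by have := hlt _ _ h; omega) (by have := hM _ (e x).2; omega) hxy.symm
  · intro x y hxy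
    have : (e x : ℕ) ≠ e y := fun h => hxy (e.injective (Fin.ext h))
    rcases lt_or_gt_of_ne this with h | h
    · exact hfw _ _ h (e y).2
    · exact hb _ _ h (e x).2

/-- indegree -/
noncomputable def ind [Fintype V] (T : Digr V) (v : V) : ℕ :=
  (Finset.univ.filter fun u => T.Adj u v).card

/-- middle vertices of two-arc walks -/
noncomputable def mid [Fintype V] (T : Digr V) (u v : V) : Finset V :=
  Finset.univ.filter fun w => T.Adj u w ∧ T.Adj w v

lemma mid_card [Fintype V] {T : Digr V} (hT : T.IsTournament) (u v : V) (R : Finset V)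
    (hR : ∀ w ∈ R, T.Adj w u ∧ ¬ T.Adj w v) :
    ind T v + R.card ≤ ind T u + (mid T u v).card + 1 := by
  have h1 : (Finset.univ.filter fun w => T.Adj w v) ∪ R ⊆
      insert u ((Finset.univ.filter fun w => T.Adj w u) ∪ mid T u v) := by
    intro w hw
    simp only [Finset.mem_union, Finset.mem_filter, Finset.mem_univ, true_and,
      Finset.mem_insert, mid] at hw ⊢
    rcases hw with hw | hw
    · by_cases hwu : w = u
      · exact Or.inl hwu
      · have := hT w u hwu
        tauto
    · exact Or.inr (Or.inl (hR w hw).1)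
  have h2 := Finset.card_le_card h1
  rw [Finset.card_union_of_disjoint] at h2
  · have h3 := Finset.card_insert_le u ((Finset.univ.filter fun w => T.Adj w u) ∪ mid T u v)
    have h4 := Finset.card_union_le (Finset.univ.filter fun w => T.Adj w u) (mid T u v)
    unfold ind
    omega
  · rw [Finset.disjoint_left]
    intro w hw hw'
    exact (hR w hw').2 (Finset.mem_filter.1 hw).2

lemma adj_asymm {T : Digr V} (hT : T.IsTournament) {u v : V} (h : T.Adj u v) : ¬ T.Adj v u := by
  have : u ≠ v := by
    rintro rfl
    exact T.loopless _ h
  exact (hT u v this).1 h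

/-- Many vertices of similar indegree yield an immersion. -/
lemma hasImm_of_degrees {VH : Type} [Fintype VH] (H : Digr VH) [Fintype V] {T : Digr V}
    (hT : T.IsTournament) (N S l d : ℕ) (hN : 5 * Fintype.card (VH × VH) ≤ N)
    (hS : N + l + 2 ≤ S) (X : Finset V) (hX : ∀ v ∈ X, d ≤ ind T v ∧ ind T v ≤ d + l)
    (hc : 2 ^ ((Fintype.card VH + 2) * S) ≤ X.card) : HasImm H T := by
  obtain ⟨f, f1, f2⟩ := exists_transitive T.Adj _ X (fun x _ y _ hxy => by
    have := hT x y hxy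
    tauto) hc
  have hM : ∀ j, j < Fintype.card VH → (j + 1) * S + S ≤ (Fintype.card VH + 2) * S := by
    intro j hj
    nlinarith [Nat.mul_le_mul_right S (by omega : j + 2 ≤ Fintype.card VH + 2)]
  have hfinj : ∀ i j, i < j → j < (Fintype.card VH + 2) * S → f i ≠ f j := by
    intro i j hij hj h
    have := f2 i j hij hj
    rw [h] at this
    exact T.loopless _ this
  apply hasImm_of_transitive H T N S hN (by omega) f f2
  intro i j hij hj
  have h1 : (i + 1) * S + S ≤ (j + 1) * S := by
    nlinarith [Nat.mul_le_mul_right S (by omega : i + 2 ≤ j + 1)]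
  have h2 := hM j hj
  apply link_of_mid (mid T _ _) (fun w hw => (Finset.mem_filter.1 hw).2)
    (hfinj _ _ (by omega) (by omega)).symm
  have h3 := mid_card hT (f ((j + 1) * S)) (f ((i + 1) * S))
    ((Finset.range (S - 1)).image fun q => f ((i + 1) * S + 1 + q)) (by
      intro w hw
      obtain ⟨q, hq, rfl⟩ := Finset.mem_image.1 hw
      have hq := Finset.mem_range.1 hq
      exact ⟨f2 _ _ (by omega) (by omega), adj_asymm hT (f2 _ _ (by omega) (by omega))⟩)
  rw [Finset.card_image_of_injOn, Finset.card_range] at h3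
  · have h4 := hX _ (f1 ((i + 1) * S) (by omega))
    have h5 := hX _ (f1 ((j + 1) * S) (by omega))
    omega
  · intro a ha b hb hab
    have ha := Finset.mem_range.1 ha
    have hb := Finset.mem_range.1 hb
    by_contra hne
    rcases lt_or_gt_of_ne hne with h | h
    · exact hfinj _ _ (by omega) (by omega) hab
    · exact hfinj _ _ (by omega) (by omega) hab.symm

/-- Many triangles through a vertex, otherwise disjoint, yield an immersion. -/
lemma hasImm_of_triangles {VH α : Type} [Fintype VH] (H : Digr VH) {T : Digr V}
    (hT : T.IsTournament) (N S : ℕ) (hN : 5 * Fintype.card (VH × VH) ≤ N)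
    (hS : N + 1 ≤ S) (v : V) (I : Finset α) (w b : α → V)
    (hw : Set.InjOn w I) (hb : Set.InjOn b I)
    (h : ∀ i ∈ I, T.Adj v (w i) ∧ T.Adj (w i) (b i) ∧ T.Adj (b i) v)
    (hc : 2 ^ ((Fintype.card VH + 2) * S) ≤ I.card) : HasImm H T := by
  obtain ⟨g, g1, g2⟩ := exists_transitive (fun x y => T.Adj (w x) (w y)) _ I
    (fun x hx y hy hxy => by
      have := hT (w x) (w y) (fun h => hxy (hw hx hy h))
      tauto) hc
  apply hasImm_of_transitive H T N S hN hS (fun i => w (g i)) g2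
  intro i j hij hj
  have h1 : (i + 1) * S + S ≤ (j + 1) * S := by
    nlinarith [Nat.mul_le_mul_right S (by omega : i + 2 ≤ j + 1)]
  have h2 : (j + 1) * S + S ≤ (Fintype.card VH + 2) * S := by
    nlinarith [Nat.mul_le_mul_right S (by omega : j + 2 ≤ Fintype.card VH + 2)]
  have h3 : (i + 1) * S = i * S + S := by ring
  generalize (Fintype.card VH + 2) * S = M at *
  have A := fun i hi => (h (g i) (g1 i hi)).1
  have B := fun i hi => (h (g i) (g1 i hi)).2.1
  have C := fun i hi => (h (g i) (g1 i hi)).2.2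
  have ginj : ∀ i j, i < M → j < M → i ≠ j → w (g i) ≠ w (g j) := by
    intro i j hi hj hij h
    rcases lt_or_gt_of_ne hij with h' | h'
    · have := g2 i j h' hj
      rw [h] at this
      exact T.loopless _ this
    · have := g2 j i h' hi
      rw [h] at this
      exact T.loopless _ this
  have binj : ∀ i j, i < M → j < M → i ≠ j → b (g i) ≠ b (g j) := by
    intro i j hi hj hij h
    exact ginj i j hi hj hij (congrArg w (hb (g1 i hi) (g1 j hj) h))
  have wv : ∀ i, i < M → w (g i) ≠ v := by
    intro i hi h
    have := A i hi
    rw [h] at this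
    exact T.loopless _ this
  have bv : ∀ i, i < M → b (g i) ≠ v := by
    intro i hi h
    have := C i hi
    rw [h] at this
    exact T.loopless _ this
  have wb : ∀ i j, i < M → j < M → w (g i) ≠ b (g j) := by
    intro i j hi hj h
    have := A i hi
    rw [h] at this
    exact adj_asymm hT this (C j hj)
  generalize (j + 1) * S = J at *
  generalize (i + 1) * S = K at *
  generalize i * S = K' at *
  refine ⟨fun q => [w (g J), w (g (J + 1 + q)), b (g (J + 1 + q)), v, w (g (K' + q)), w (g K)],
    ?_, ?_⟩
  · intro q
    have hq := q.2
    simp only [List.isChain_cons_cons, List.isChain_singleton, and_true]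
    refine ⟨⟨g2 _ _ (by omega) (by omega), B _ (by omega), C _ (by omega), A _ (by omega),
      g2 _ _ (by omega) (by omega)⟩, by simp, by simp, by simp⟩
  · intro q q' hqq x hx hx'
    have hq := q.2
    have hq' := q'.2
    have hne : (q : ℕ) ≠ q' := fun h => hqq (Fin.ext h)
    have e1 := ginj (J + 1 + q) (J + 1 + q') (by omega) (by omega) (by omega)
    have e2 := ginj (K' + q) (K' + q') (by omega) (by omega) (by omega)
    have e3 := ginj (J + 1 + q) J (by omega) (by omega) (by omega)
    have e4 := ginj (J + 1 + q') J (by omega) (by omega) (by omega)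
    have e5 := ginj (K' + q) J (by omega) (by omega) (by omega)
    have e6 := ginj (K' + q') J (by omega) (by omega) (by omega)
    have e7 := binj (J + 1 + q) (J + 1 + q') (by omega) (by omega) (by omega)
    have v1 := wv J (by omega)
    have v3 := wv (J + 1 + q) (by omega)
    have v4 := wv (J + 1 + q') (by omega)
    have v5 := wv (K' + q) (by omega)
    have v6 := wv (K' + q') (by omega)
    have v2 := wv K (by omega)
    have b1 := bv (J + 1 + q) (by omega)
    have b2 := bv (J + 1 + q') (by omega)
    have w1 := wb J (J + 1 + q) (by omega) (by omega)
    have w2 := wb J (J + 1 + q') (by omega) (by omega)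
    have w3 := wb K (J + 1 + q) (by omega) (by omega)
    have w4 := wb K (J + 1 + q') (by omega) (by omega)
    have w5 := ginj (J + 1 + q) (K' + q') (by omega) (by omega) (by omega)
    have w6 := ginj (J + 1 + q') (K' + q) (by omega) (by omega) (by omega)
    simp only [listArcs, List.tail_cons, List.zip_cons_cons, List.zip_nil_right, List.mem_cons,
      List.not_mem_nil, or_false] at hx hx'
    clear h1 h2 h3 A B C ginj binj wv bv wb hqq hne
    rcases hx with rfl | rfl | rfl | rfl | rfl <;> simp only [Prod.mk.injEq] at hx' <;> grind

/-- distinct representatives, greedily -/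
lemma exists_sdr {α : Type} (R : α → Finset V) (I : Finset α)
    (h : ∀ i ∈ I, I.card ≤ (R i).card) [Nonempty V] :
    ∃ w : α → V, Set.InjOn w I ∧ ∀ i ∈ I, w i ∈ R i := by
  induction I using Finset.induction_on with
  | empty => exact ⟨fun _ => Classical.arbitrary V, by simp, by simp⟩
  | insert a I ha ih =>
    rw [Finset.card_insert_of_notMem ha] at h
    obtain ⟨w, w1, w2⟩ := ih fun i hi => by
      have := h i (Finset.mem_insert_of_mem hi)
      omega
    obtain ⟨x, hx, hx'⟩ := Finset.exists_mem_notMem_of_card_lt_card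
      (s := I.image w) (t := R a) (by
        have := h a (Finset.mem_insert_self _ _)
        have := Finset.card_image_le (s := I) (f := w)
        omega)
    have hx2 : ∀ i ∈ I, w i ≠ x := fun i hi h => hx' (Finset.mem_image.2 ⟨i, hi, h⟩)
    have hne : ∀ i ∈ I, i ≠ a := fun i hi h => ha (h ▸ hi)
    refine ⟨Function.update w a x, ?_, ?_⟩
    · intro i hi j hj hij
      simp only [Finset.coe_insert, Set.mem_insert_iff, Finset.mem_coe] at hi hj
      rcases hi with rfl | hi <;> rcases hj with rfl | hj
      · rfl
      · rw [Function.update_self, Function.update_of_ne (hne j hj)] at hij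
        exact absurd hij.symm (hx2 j hj)
      · rw [Function.update_self, Function.update_of_ne (hne i hi)] at hij
        exact absurd hij (hx2 i hi)
      · rw [Function.update_of_ne (hne i hi), Function.update_of_ne (hne j hj)] at hij
        exact w1 hi hj hij
    · intro i hi
      rcases Finset.mem_insert.1 hi with rfl | hi
      · rwa [Function.update_self]
      · rw [Function.update_of_ne (hne i hi)]
        exact w2 i hi

/-- A backward matching between vertices of low indegree and vertices of high indegree. -/
lemma hasImm_of_matching {VH : Type} [Fintype VH] (H : Digr VH) [Fintype V] {T : Digr V}
    (hT : T.IsTournament) (N S d : ℕ) (hN : 5 * Fintype.card (VH × VH) ≤ N)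
    (hS : N + 1 ≤ S) (F : Finset (V × V))
    (hF1 : Set.InjOn Prod.fst (F : Set (V × V))) (hF2 : Set.InjOn Prod.snd (F : Set (V × V)))
    (h : ∀ e ∈ F, T.Adj e.1 e.2 ∧ ind T e.2 ≤ d ∧ d + N + 1 ≤ ind T e.1)
    (hc : 2 ^ ((Fintype.card VH + 2) * S) ≤ F.card) : HasImm H T := by
  obtain ⟨g, g1, g2⟩ := exists_transitive (fun x y : V × V => T.Adj x.2 y.2) _ F
    (fun x hx y hy hxy => by
      have := hT x.2 y.2 (fun h => hxy (hF2 hx hy h))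
      tauto) hc
  apply hasImm_of_transitive H T N S hN hS (fun i => (g i).2) g2
  intro i j hij hj
  have h1 : (i + 1) * S + S ≤ (j + 1) * S := by
    nlinarith [Nat.mul_le_mul_right S (by omega : i + 2 ≤ j + 1)]
  have h2 : (j + 1) * S + S ≤ (Fintype.card VH + 2) * S := by
    nlinarith [Nat.mul_le_mul_right S (by omega : j + 2 ≤ Fintype.card VH + 2)]
  have h3 : (i + 1) * S = i * S + S := by ring
  generalize (Fintype.card VH + 2) * S = M at *
  have A := fun i hi => (h (g i) (g1 i hi)).1
  have B := fun i hi => (h (g i) (g1 i hi)).2.1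
  have C := fun i hi => (h (g i) (g1 i hi)).2.2
  have ginj : ∀ i j, i < M → j < M → i ≠ j → (g i).2 ≠ (g j).2 := by
    intro i j hi hj hij h
    rcases lt_or_gt_of_ne hij with h' | h'
    · have := g2 i j h' hj
      rw [h] at this
      exact T.loopless _ this
    · have := g2 j i h' hi
      rw [h] at this
      exact T.loopless _ this
  have binj : ∀ i j, i < M → j < M → i ≠ j → (g i).1 ≠ (g j).1 := by
    intro i j hi hj hij h
    exact ginj i j hi hj hij (congrArg Prod.snd (hF1 (g1 i hi) (g1 j hj) h))
  have ab : ∀ i j, i < M → j < M → (g i).2 ≠ (g j).1 := by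
    intro i j hi hj h
    have := B i hi
    have := C j hj
    rw [h] at *
    omega
  generalize (j + 1) * S = J at *
  generalize (i + 1) * S = K at *
  generalize i * S = K' at *
  have : Nonempty V := ⟨(g 0).1⟩
  obtain ⟨m, m1, m2⟩ := exists_sdr (fun q => mid T (g J).2 (g (K' + q)).1) (Finset.range N) (by
    intro q hq
    have hq := Finset.mem_range.1 hq
    rw [Finset.card_range]
    have t1 := mid_card hT (g J).2 (g (K' + q)).1 ∅ (by simp)
    have t2 := B J (by omega)
    have t3 := C (K' + q) (by omega)
    simp only [Finset.card_empty] at t1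
    omega)
  have m3 : ∀ q < N, T.Adj (g J).2 (m q) ∧ T.Adj (m q) (g (K' + q)).1 := fun q hq =>
    (Finset.mem_filter.1 (m2 q (Finset.mem_range.2 hq))).2
  have mJ : ∀ q < N, m q ≠ (g J).2 := by
    intro q hq h
    have := (m3 q hq).1
    rw [h] at this
    exact T.loopless _ this
  refine ⟨fun q => [(g J).2, m q, (g (K' + q)).1, (g (K' + q)).2, (g K).2],
    ?_, ?_⟩
  · intro q
    have hq := q.2
    simp only [List.isChain_cons_cons, List.isChain_singleton, and_true]
    refine ⟨⟨(m3 q hq).1, (m3 q hq).2, A _ (by omega),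
      g2 _ _ (by omega) (by omega)⟩, by simp, by simp, by simp⟩
  · intro q q' hqq x hx hx'
    have hq := q.2
    have hq' := q'.2
    have hne : (q : ℕ) ≠ q' := fun h => hqq (Fin.ext h)
    have e1 : m q ≠ m q' := fun h =>
      hne (m1 (by simpa using hq) (by simpa using hq') h)
    have e2 := ginj (K' + q) (K' + q') (by omega) (by omega) (by omega)
    have e5 := ginj (K' + q) J (by omega) (by omega) (by omega)
    have e6 := ginj (K' + q') J (by omega) (by omega) (by omega)
    have e7 := binj (K' + q) (K' + q') (by omega) (by omega) (by omega)
    have e8 := mJ q hq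
    have e9 := mJ q' hq'
    have w1 := ab J (K' + q) (by omega) (by omega)
    have w2 := ab J (K' + q') (by omega) (by omega)
    have w3 := ab K (K' + q) (by omega) (by omega)
    have w4 := ab K (K' + q') (by omega) (by omega)
    have w5 := ab (K' + q) (K' + q') (by omega) (by omega)
    have w6 := ab (K' + q') (K' + q) (by omega) (by omega)
    simp only [listArcs, List.tail_cons, List.zip_cons_cons, List.zip_nil_right, List.mem_cons,
      List.not_mem_nil, or_false] at hx hx'
    clear h1 h2 h3 A B C ginj binj ab hqq hne m1 m2 m3 mJ
    rcases hx with rfl | rfl | rfl | rfl <;> simp only [Prod.mk.injEq] at hx' <;> grind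

/-- greedy matching -/
lemma exists_matching (D : ℕ) (t : ℕ) : ∀ (E : Finset (V × V)),
    (∀ v, (E.filter fun e => e.1 = v).card ≤ D) → (∀ v, (E.filter fun e => e.2 = v).card ≤ D) →
    2 * D * t < E.card →
    ∃ F ⊆ E, F.card = t ∧ Set.InjOn Prod.fst (F : Set (V × V)) ∧
      Set.InjOn Prod.snd (F : Set (V × V)) := by
  induction t with
  | zero => intro E _ _ _; exact ⟨∅, by simp, by simp, by simp, by simp⟩
  | succ t ih =>
    intro E h1 h2 hc
    obtain ⟨a, ha⟩ := Finset.card_pos.1 (by omega : 0 < E.card)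
    let E' := E.filter fun e => ¬ (e.1 = a.1 ∨ e.2 = a.2)
    have hsub : E' ⊆ E := Finset.filter_subset _ _
    have hE' : 2 * D * t < E'.card := by
      have s1 := Finset.card_filter_add_card_filter_not (s := E)
        (fun e => e.1 = a.1 ∨ e.2 = a.2)
      rw [Finset.filter_or] at s1
      have s2 := Finset.card_union_le (E.filter fun e => e.1 = a.1) (E.filter fun e => e.2 = a.2)
      have := h1 a.1
      have := h2 a.2
      have : 2 * D * (t + 1) = 2 * D * t + 2 * D := by ring
      have : E'.card = (E.filter fun e => ¬ (e.1 = a.1 ∨ e.2 = a.2)).card := rfl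
      omega
    obtain ⟨F, F1, F2, F3, F4⟩ := ih E'
      (fun v => le_trans (Finset.card_le_card (Finset.filter_subset_filter _ hsub)) (h1 v))
      (fun v => le_trans (Finset.card_le_card (Finset.filter_subset_filter _ hsub)) (h2 v)) hE'
    have hF : ∀ e ∈ F, e.1 ≠ a.1 ∧ e.2 ≠ a.2 := by
      intro e he
      have := (Finset.mem_filter.1 (F1 he)).2
      tauto
    have haF : a ∉ F := fun h => (hF a h).1 rfl
    refine ⟨insert a F, ?_, ?_, ?_, ?_⟩
    · exact Finset.insert_subset ha (F1.trans hsub)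
    · rw [Finset.card_insert_of_notMem haF, F2]
    · rw [Finset.coe_insert, Set.injOn_insert (by simpa using haF)]
      refine ⟨F3, ?_⟩
      rintro ⟨e, he, hea⟩
      exact (hF e he).1 hea
    · rw [Finset.coe_insert, Set.injOn_insert (by simpa using haF)]
      refine ⟨F4, ?_⟩
      rintro ⟨e, he, hea⟩
      exact (hF e he).2 hea

lemma exists_degree_ordering [Fintype V] (d : V → ℕ) :
    ∃ σ : V → ℕ, IsOrdering σ ∧ ∀ u v, σ u ≤ σ v → d u ≤ d v := by
  let e := Fintype.equivFin V
  let f : Fin (Fintype.card V) → ℕ := d ∘ e.symm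
  refine ⟨fun v => ((Tuple.sort f).symm (e v) : ℕ) + 1, ⟨?_, ?_, ?_⟩, ?_⟩
  · intro v _
    have := ((Tuple.sort f).symm (e v)).2
    simp only [Set.mem_Icc]
    omega
  · intro u _ v _ huv
    have : (Tuple.sort f).symm (e u) = (Tuple.sort f).symm (e v) := Fin.ext (by simpa using huv)
    simpa using this
  · intro k hk
    obtain ⟨hk1, hk2⟩ := hk
    refine ⟨e.symm (Tuple.sort f ⟨k - 1, by omega⟩), trivial, ?_⟩
    simp
    omega
  · intro u v huv
    have h1 : (Tuple.sort f).symm (e u) ≤ (Tuple.sort f).symm (e v) := by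
      simpa using huv
    have h2 := Tuple.monotone_sort f h1
    simpa [f] using h2

/-- Removing the pairs whose image lies in a small set. -/
lemma card_filter_notMem_ge {α : Type} (F : Finset α) (p : α → V) (hp : Set.InjOn p F)
    (X : Finset V) (Q k : ℕ) (hF : Q + k ≤ F.card) (hX : X.card < k) :
    ∃ I ⊆ F, I.card = Q ∧ ∀ e ∈ I, p e ∉ X := by
  have h1 := Finset.card_filter_add_card_filter_not (s := F) (fun e => p e ∈ X)
  have h2 : (F.filter fun e => p e ∈ X).card ≤ X.card :=
    Finset.card_le_card_of_injOn p (fun e he => (Finset.mem_filter.1 he).2)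
      (hp.mono (by intro e he; exact (Finset.mem_filter.1 he).1))
  obtain ⟨I, hI, hc⟩ := Finset.exists_subset_card_eq
    (s := F.filter fun e => ¬ p e ∈ X) (n := Q) (by omega)
  exact ⟨I, hI.trans (Finset.filter_subset _ _), hc, fun e he => (Finset.mem_filter.1 (hI he)).2⟩

lemma cut_bound {VH : Type} [Fintype VH] (H : Digr VH) [Fintype V] {T : Digr V}
    (hT : T.IsTournament) (hH : ¬ HasImm H T) (N Q s k d : ℕ)
    (hN : 5 * Fintype.card (VH × VH) ≤ N)
    (hQ : Q = 2 ^ ((Fintype.card VH + 2) * (N + 1)))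
    (hs : s = Q + N + 2)
    (hk : k = 2 ^ ((Fintype.card VH + 2) * (N + s + 2)))
    (E : Finset (V × V))
    (hE : ∀ e ∈ E, T.Adj e.1 e.2 ∧ ind T e.2 ≤ d ∧ d ≤ ind T e.1) :
    E.card ≤ 2 * (Q + k) * (Q + k) := by
  by_contra hcard
  push Not at hcard
  have hX1 : (Finset.univ.filter fun v => d - s ≤ ind T v ∧ ind T v ≤ d).card < k := by
    by_contra hcon
    apply hH
    refine hasImm_of_degrees H hT N (N + s + 2) s (d - s) hN le_rfl _ ?_ (hk ▸ not_lt.1 hcon)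
    intro v hv
    have := (Finset.mem_filter.1 hv).2
    omega
  have hX2 : (Finset.univ.filter fun v => d ≤ ind T v ∧ ind T v ≤ d + s).card < k := by
    by_contra hcon
    apply hH
    refine hasImm_of_degrees H hT N (N + s + 2) s d hN le_rfl _ ?_ (hk ▸ not_lt.1 hcon)
    intro v hv
    exact (Finset.mem_filter.1 hv).2
  by_cases hA : ∀ v, (E.filter fun e => e.1 = v).card ≤ Q + k
  · by_cases hB : ∀ v, (E.filter fun e => e.2 = v).card ≤ Q + k
    · obtain ⟨F, F1, F2, F3, F4⟩ := exists_matching (Q + k) (Q + k) E hA hB hcard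
      obtain ⟨I, I1, I2, I3⟩ := card_filter_notMem_ge F Prod.fst F3 _ Q k F2.ge hX2
      apply hH
      refine hasImm_of_matching H hT N (N + 1) d hN le_rfl I (F3.mono (by exact_mod_cast I1))
        (F4.mono (by exact_mod_cast I1)) ?_ (by omega)
      intro e he
      have h1 := hE e (F1 (I1 he))
      have h2 := I3 e he
      simp only [Finset.mem_filter, Finset.mem_univ, true_and] at h2
      refine ⟨h1.1, h1.2.1, ?_⟩
      omega
    · push Not at hB
      obtain ⟨v, hv⟩ := hB
      have hinj : Set.InjOn Prod.fst ((E.filter fun e => e.2 = v : Finset (V × V)) : Set (V × V)) := by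
        intro e he e' he' h
        have h1 := (Finset.mem_filter.1 he).2
        have h2 := (Finset.mem_filter.1 he').2
        exact Prod.ext h (h1.trans h2.symm)
      obtain ⟨I, I1, I2, I3⟩ := card_filter_notMem_ge _ Prod.fst hinj _ Q k hv.le hX2
      have : Nonempty V := ⟨v⟩
      have I4 : ∀ e ∈ I, (T.Adj e.1 v ∧ ind T v ≤ d ∧ d ≤ ind T e.1) ∧ d + s < ind T e.1 := by
        intro e he
        have h0 := Finset.mem_filter.1 (I1 he)
        have h1 := hE e h0.1
        rw [h0.2] at h1
        refine ⟨h1, ?_⟩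
        have h2 := I3 e he
        simp only [Finset.mem_filter, Finset.mem_univ, true_and] at h2
        omega
      obtain ⟨m, m1, m2⟩ := exists_sdr (fun e : V × V => mid T v e.1) I (by
        intro e he
        have h1 := I4 e he
        have h2 := mid_card hT v e.1 ∅ (by simp)
        simp only [Finset.card_empty] at h2
        omega)
      apply hH
      refine hasImm_of_triangles H hT N (N + 1) hN le_rfl v I m Prod.fst m1
        (hinj.mono (by exact_mod_cast I1)) ?_ (by omega)
      intro e he
      have := (Finset.mem_filter.1 (m2 e he)).2
      exact ⟨this.1, this.2, (I4 e he).1.1⟩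
  · push Not at hA
    obtain ⟨v, hv⟩ := hA
    have hinj : Set.InjOn Prod.snd ((E.filter fun e => e.1 = v : Finset (V × V)) : Set (V × V)) := by
      intro e he e' he' h
      have h1 := (Finset.mem_filter.1 he).2
      have h2 := (Finset.mem_filter.1 he').2
      exact Prod.ext (h1.trans h2.symm) h
    obtain ⟨I, I1, I2, I3⟩ := card_filter_notMem_ge _ Prod.snd hinj _ Q k hv.le hX1
    have : Nonempty V := ⟨v⟩
    have I4 : ∀ e ∈ I, (T.Adj v e.2 ∧ ind T e.2 ≤ d ∧ d ≤ ind T v) ∧ ind T e.2 < d - s := by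
      intro e he
      have h0 := Finset.mem_filter.1 (I1 he)
      have h1 := hE e h0.1
      rw [h0.2] at h1
      refine ⟨h1, ?_⟩
      have h2 := I3 e he
      simp only [Finset.mem_filter, Finset.mem_univ, true_and] at h2
      omega
    obtain ⟨m, m1, m2⟩ := exists_sdr (fun e : V × V => mid T e.2 v) I (by
      intro e he
      have h1 := I4 e he
      have h2 := mid_card hT e.2 v ∅ (by simp)
      simp only [Finset.card_empty] at h2
      omega)
    apply hH
    refine hasImm_of_triangles H hT N (N + 1) hN le_rfl v I Prod.snd m
      (hinj.mono (by exact_mod_cast I1)) m1 ?_ (by omega)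
    intro e he
    have := (Finset.mem_filter.1 (m2 e he)).2
    exact ⟨(I4 e he).1.1, this.1, this.2⟩


/-- for every simple digraph `H` there is a constant `c_H` bounding the
cutwidth of every `H`-immersion-free tournament. -/
theorem exists_ctw_bound_of_immersion_free
    {VH : Type} [Fintype VH] (H : Digr VH) :
    ∃ cH : ℕ, ∀ (V : Type) [Fintype V] (T : Digr V),
      T.IsTournament → ¬ HasImm H T → ctw T ≤ cH := by
  obtain ⟨N, hN⟩ : ∃ N, N = 5 * Fintype.card (VH × VH) := ⟨_, rfl⟩
  obtain ⟨Q, hQ⟩ : ∃ Q, Q = 2 ^ ((Fintype.card VH + 2) * (N + 1)) := ⟨_, rfl⟩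
  obtain ⟨s, hs⟩ : ∃ s, s = Q + N + 2 := ⟨_, rfl⟩
  obtain ⟨k, hk⟩ : ∃ k, k = 2 ^ ((Fintype.card VH + 2) * (N + s + 2)) := ⟨_, rfl⟩
  refine ⟨2 * (Q + k) * (Q + k), ?_⟩
  intro V _ T hT hH
  obtain ⟨σ, hσ, hd⟩ := exists_degree_ordering (ind T)
  refine le_trans (Nat.sInf_le ⟨σ, hσ, rfl⟩) ?_
  refine Finset.sup_le fun γ _ => ?_
  rw [Set.ncard_eq_toFinset_card']
  apply cut_bound H hT hH N Q s k
    ((Finset.univ.filter fun v => σ v ≤ γ).sup (ind T)) hN.ge hQ hs hk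
  intro e he
  have he : T.Adj e.1 e.2 ∧ γ < σ e.1 ∧ σ e.2 ≤ γ := by
    have h0 : e ∈ cutAt T σ γ := Set.mem_toFinset.1 he
    exact h0
  refine ⟨he.1, Finset.le_sup (by simpa using he.2.2), Finset.sup_le ?_⟩
  intro v hv
  have hv : σ v ≤ γ := by simpa using hv
  exact hd _ _ (by omega)

end TournamentPaper
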